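/- For every ℓ > 0 there exists a constant C = C(ℓ) > 0 such that for every smooth map u : ℝ × ℝ → ℝ³, ℓ-periodic in the second variable, with |u(t,s)| = 1 everywhere and solving ∂ₜu = ∂ₛ(u × ∂ₛu), with u⁰ := u(0,·), and for every t ∈ ℝ: ‖∂ₛₛₛu(t,·)‖₂² ≤ C·( ‖∂ₛₛu⁰‖₂⁴ + ‖∂ₛₛₛu⁰‖₂² )·exp( C·( ‖∂ₛu⁰‖₂⁶ + ‖∂ₛₛu⁰‖₂² )·|t| ), where ‖g‖₂ := (∫₀^ℓ |g(s)|² ds)^{1/2}. -/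

import Mathlib

noncomputable section
open Real MeasureTheory

/-- `ℝ³` as Euclidean space. -/
abbrev R3 : Type := EuclideanSpace ℝ (Fin 3)

/-- Pack three real numbers into a vector of `ℝ³`. -/
def toE (v : Fin 3 → ℝ) : R3 := (EuclideanSpace.equiv (Fin 3) ℝ).symm v

/-- The cross product on `ℝ³`. -/
def cross3 (a b : R3) : R3 :=
  toE ![a 1 * b 2 - a 2 * b 1, a 2 * b 0 - a 0 * b 2, a 0 * b 1 - a 1 * b 0]

/-! ### Calculus of functions of two variables -/

/-- Joint smoothness of a function of two real variables. -/
def Smooth2 {E : Type*} [NormedAddCommGroup E] [NormedSpace ℝ E] (F : ℝ → ℝ → E) : Prop :=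
  ContDiff ℝ (⊤ : ℕ∞) (fun p : ℝ × ℝ => F p.1 p.2)

section calc2
variable {E : Type*} [NormedAddCommGroup E] [NormedSpace ℝ E] {F : ℝ → ℝ → E}

lemma Smooth2.hasFDerivAt (hF : Smooth2 F) (p : ℝ × ℝ) :
    HasFDerivAt (fun p : ℝ × ℝ => F p.1 p.2) (fderiv ℝ (fun p : ℝ × ℝ => F p.1 p.2) p) p :=
  (ContDiff.differentiable hF (by simp) p).hasFDerivAt

lemma hasDerivAt_mk_right (t s : ℝ) : HasDerivAt (fun σ : ℝ => (t, σ)) ((0 : ℝ), (1 : ℝ)) s :=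
  (hasDerivAt_const s t).prodMk (hasDerivAt_id s)

lemma hasDerivAt_mk_left (t s : ℝ) : HasDerivAt (fun τ : ℝ => (τ, s)) ((1 : ℝ), (0 : ℝ)) t :=
  (hasDerivAt_id t).prodMk (hasDerivAt_const t s)

lemma Smooth2.hasDerivAt_right' (hF : Smooth2 F) (t s : ℝ) :
    HasDerivAt (F t) (fderiv ℝ (fun p : ℝ × ℝ => F p.1 p.2) (t, s) (0, 1)) s :=
  (hF.hasFDerivAt (t, s)).comp_hasDerivAt s (hasDerivAt_mk_right t s)

lemma Smooth2.hasDerivAt_left' (hF : Smooth2 F) (t s : ℝ) :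
    HasDerivAt (fun τ => F τ s) (fderiv ℝ (fun p : ℝ × ℝ => F p.1 p.2) (t, s) (1, 0)) t :=
  HasFDerivAt.comp_hasDerivAt (l := fun p : ℝ × ℝ => F p.1 p.2) t (hF.hasFDerivAt (t, s))
    (hasDerivAt_mk_left t s)

lemma Smooth2.hasDerivAt_right (hF : Smooth2 F) (t s : ℝ) :
    HasDerivAt (F t) (deriv (F t) s) s :=
  (hF.hasDerivAt_right' t s).differentiableAt.hasDerivAt

lemma Smooth2.hasDerivAt_left (hF : Smooth2 F) (t s : ℝ) :
    HasDerivAt (fun τ => F τ s) (deriv (fun τ => F τ s) t) t :=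
  (hF.hasDerivAt_left' t s).differentiableAt.hasDerivAt

lemma Smooth2.fderiv (hF : Smooth2 F) :
    ContDiff ℝ (⊤ : ℕ∞) (fderiv ℝ (fun p : ℝ × ℝ => F p.1 p.2)) :=
  ContDiff.fderiv_right hF (by simp)

lemma Smooth2.deriv_right (hF : Smooth2 F) : Smooth2 (fun t => deriv (F t)) := by
  have h : (fun p : ℝ × ℝ => deriv (F p.1) p.2) =
      fun p => _root_.fderiv ℝ (fun p : ℝ × ℝ => F p.1 p.2) p (0, 1) := by
    funext p
    exact (hF.hasDerivAt_right' p.1 p.2).deriv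
  unfold Smooth2
  rw [h]
  exact hF.fderiv.clm_apply contDiff_const

lemma Smooth2.deriv_left (hF : Smooth2 F) : Smooth2 (fun t s => deriv (fun τ => F τ s) t) := by
  have h : (fun p : ℝ × ℝ => deriv (fun τ => F τ p.2) p.1) =
      fun p => _root_.fderiv ℝ (fun p : ℝ × ℝ => F p.1 p.2) p (1, 0) := by
    funext p
    exact (hF.hasDerivAt_left' p.1 p.2).deriv
  unfold Smooth2
  rw [h]
  exact hF.fderiv.clm_apply contDiff_const

lemma Smooth2.continuous (hF : Smooth2 F) : Continuous (fun p : ℝ × ℝ => F p.1 p.2) :=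
  ContDiff.continuous hF

lemma Smooth2.continuous_right (hF : Smooth2 F) (t : ℝ) : Continuous (F t) :=
  hF.continuous.comp (by fun_prop : Continuous fun s : ℝ => (t, s))

lemma hasDerivAt_clm_line {Φ : ℝ × ℝ → (ℝ × ℝ →L[ℝ] E)} {Φ' : ℝ × ℝ →L[ℝ] (ℝ × ℝ →L[ℝ] E)}
    {c : ℝ → ℝ × ℝ} {c' : ℝ × ℝ} {x : ℝ} (h : HasFDerivAt Φ Φ' (c x)) (hc : HasDerivAt c c' x)
    (w : ℝ × ℝ) : HasDerivAt (fun y => Φ (c y) w) (Φ' c' w) x := by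
  have h1 : HasDerivAt (fun y => Φ (c y)) (Φ' c') x := h.comp_hasDerivAt x hc
  exact ((ContinuousLinearMap.apply ℝ E w).hasFDerivAt (x := Φ (c x))).comp_hasDerivAt x h1

/-- Mixed partial derivatives commute. -/
lemma Smooth2.hasDerivAt_swap (hF : Smooth2 F) {G : ℝ → ℝ → E}
    (hG : ∀ t s, HasDerivAt (fun τ => F τ s) (G t s) t) {t s : ℝ} {G' : E}
    (hG' : HasDerivAt (G t) G' s) :
    HasDerivAt (fun τ => deriv (F τ) s) G' t := by
  set H := fun p : ℝ × ℝ => F p.1 p.2 with hH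
  have h2 : HasFDerivAt (_root_.fderiv ℝ H) (_root_.fderiv ℝ (_root_.fderiv ℝ H) (t, s)) (t, s) :=
    (hF.fderiv.differentiable (by simp) _).hasFDerivAt
  have e1 : (fun τ => deriv (F τ) s) = fun τ => _root_.fderiv ℝ H (τ, s) (0, 1) := by
    funext τ; exact (hF.hasDerivAt_right' τ s).deriv
  have e2 : G t = fun σ => _root_.fderiv ℝ H (t, σ) (1, 0) := by
    funext σ; exact (hG t σ).unique (hF.hasDerivAt_left' t σ)
  have d1 : HasDerivAt (fun τ => _root_.fderiv ℝ H (τ, s) (0, 1))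
      (_root_.fderiv ℝ (_root_.fderiv ℝ H) (t, s) (1, 0) (0, 1)) t :=
    hasDerivAt_clm_line (c := fun τ => (τ, s)) h2 (hasDerivAt_mk_left t s) _
  have d2 : HasDerivAt (fun σ => _root_.fderiv ℝ H (t, σ) (1, 0))
      (_root_.fderiv ℝ (_root_.fderiv ℝ H) (t, s) (0, 1) (1, 0)) s :=
    hasDerivAt_clm_line h2 (hasDerivAt_mk_right t s) _
  have hs : IsSymmSndFDerivAt ℝ H (t, s) :=
    ContDiffAt.isSymmSndFDerivAt (n := (⊤ : ℕ∞)) (ContDiff.contDiffAt hF)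
      (by simp only [minSmoothness_of_isRCLikeNormedField]; exact WithTop.coe_le_coe.mpr (le_top : (2 : ℕ∞) ≤ ⊤))
  rw [e2] at hG'
  rw [e1, hG'.unique d2, ← hs]
  exact d1

end calc2

/-- Differentiation under the integral sign. -/
lemma Smooth2.hasDerivAt_integral {e : ℝ → ℝ → ℝ} (he : Smooth2 e) {e' : ℝ → ℝ → ℝ}
    (he' : ∀ t s, HasDerivAt (fun τ => e τ s) (e' t s) t) (ℓ t : ℝ) :
    HasDerivAt (fun τ => ∫ s in (0 : ℝ)..ℓ, e τ s) (∫ s in (0 : ℝ)..ℓ, e' t s) t := by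
  have hee : e' = fun t s => deriv (fun τ => e τ s) t := by
    funext t s; exact ((he' t s).deriv).symm
  have hc : Continuous (fun p : ℝ × ℝ => e' p.1 p.2) := by
    rw [hee]; exact he.deriv_left.continuous
  obtain ⟨B, hB⟩ := ((isCompact_Icc (a := t - 1) (b := t + 1)).prod
    (isCompact_uIcc (a := (0 : ℝ)) (b := ℓ))).exists_bound_of_continuousOn hc.continuousOn
  refine (intervalIntegral.hasDerivAt_integral_of_dominated_loc_of_deriv_le
    (F := e) (F' := e') (s := Set.Icc (t - 1) (t + 1)) (bound := fun _ => B)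
    (Icc_mem_nhds (by linarith) (by linarith)) ?_ ?_ ?_ ?_ ?_ ?_).2
  · exact Filter.Eventually.of_forall fun x => (he.continuous_right x).aestronglyMeasurable
  · exact (he.continuous_right t).intervalIntegrable _ _
  · exact (hc.comp (by fun_prop : Continuous fun s : ℝ => (t, s))).aestronglyMeasurable
  · refine Filter.Eventually.of_forall fun s hs x hx => ?_
    exact hB (x, s) ⟨hx, Set.uIoc_subset_uIcc hs⟩
  · exact intervalIntegrable_const
  · exact Filter.Eventually.of_forall fun s hs x hx => he' x s

/-- If the time derivative of a density is a space derivative of a periodic flux plus `r`. -/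
lemma Smooth2.hasDerivAt_integral_flux {e : ℝ → ℝ → ℝ} (he : Smooth2 e) {f f' r : ℝ → ℝ → ℝ}
    {ℓ : ℝ} (hf : Smooth2 f) (hr : Smooth2 r) (hper : ∀ t, f t ℓ = f t 0)
    (hf' : ∀ t s, HasDerivAt (f t) (f' t s) s)
    (he' : ∀ t s, HasDerivAt (fun τ => e τ s) (f' t s + r t s) t) (t : ℝ) :
    HasDerivAt (fun τ => ∫ s in (0 : ℝ)..ℓ, e τ s) (∫ s in (0 : ℝ)..ℓ, r t s) t := by
  have h := he.hasDerivAt_integral he' ℓ t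
  have hf'c : Continuous (f' t) := by
    have : f' t = deriv (f t) := by funext s; exact ((hf' t s).deriv).symm
    rw [this]; exact hf.deriv_right.continuous_right t
  rw [intervalIntegral.integral_add (hf'c.intervalIntegrable _ _)
    ((hr.continuous_right t).intervalIntegrable _ _),
    intervalIntegral.integral_eq_sub_of_hasDerivAt (fun s _ => hf' t s)
      (hf'c.intervalIntegrable _ _), hper, sub_self, zero_add] at h
  exact h

/-! ### Vector algebra in `ℝ³` -/

/-- Dot product in coordinates. -/
def dt3 (a b : R3) : ℝ := a 0 * b 0 + a 1 * b 1 + a 2 * b 2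

/-- Triple product in coordinates. -/
def det3 (a b c : R3) : ℝ :=
  a 0 * (b 1 * c 2 - b 2 * c 1) + a 1 * (b 2 * c 0 - b 0 * c 2) + a 2 * (b 0 * c 1 - b 1 * c 0)

lemma norm_sq_eq_dt3 (a : R3) : ‖a‖ ^ 2 = dt3 a a := by
  rw [EuclideanSpace.norm_sq_eq, Fin.sum_univ_three]
  simp only [Real.norm_eq_abs, sq_abs, dt3]
  ring

@[simp] lemma cross3_zero (a b : R3) : cross3 a b 0 = a 1 * b 2 - a 2 * b 1 := rfl
@[simp] lemma cross3_one (a b : R3) : cross3 a b 1 = a 2 * b 0 - a 0 * b 2 := rfl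
@[simp] lemma cross3_two (a b : R3) : cross3 a b 2 = a 0 * b 1 - a 1 * b 0 := rfl

lemma dt3_comm (a b : R3) : dt3 a b = dt3 b a := by simp only [dt3]; ring
lemma dt3_add_left (a b c : R3) : dt3 (a + b) c = dt3 a c + dt3 b c := by
  simp only [dt3, PiLp.add_apply]; ring
lemma dt3_smul_left (k : ℝ) (a c : R3) : dt3 (k • a) c = k * dt3 a c := by
  simp only [dt3, PiLp.smul_apply, smul_eq_mul]; ring
lemma dt3_add_right (a b c : R3) : dt3 c (a + b) = dt3 c a + dt3 c b := by
  simp only [dt3, PiLp.add_apply]; ring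
lemma dt3_smul_right (k : ℝ) (a c : R3) : dt3 c (k • a) = k * dt3 c a := by
  simp only [dt3, PiLp.smul_apply, smul_eq_mul]; ring
lemma dt3_cross_left (a b c : R3) : dt3 (cross3 a b) c = det3 a b c := by
  simp only [dt3, det3, cross3_zero, cross3_one, cross3_two]; ring
lemma dt3_cross_right (a b c : R3) : dt3 c (cross3 a b) = det3 a b c := by
  simp only [dt3, det3, cross3_zero, cross3_one, cross3_two]; ring

lemma exists_unit_orth (u : R3) : ∃ e : R3, dt3 e e = 1 ∧ dt3 u e = 0 := by
  by_cases h : u 0 ^ 2 + u 1 ^ 2 = 0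
  · have h0 : u 0 = 0 := by nlinarith [sq_nonneg (u 0), sq_nonneg (u 1)]
    refine ⟨toE ![1, 0, 0], ?_, ?_⟩ <;> simp [dt3, toE, h0]
  · have hp : 0 < u 0 ^ 2 + u 1 ^ 2 := lt_of_le_of_ne (by positivity) (Ne.symm h)
    set r := √(u 0 ^ 2 + u 1 ^ 2) with hr
    have hr2 : r ^ 2 = u 0 ^ 2 + u 1 ^ 2 := Real.sq_sqrt hp.le
    have hr0 : r ≠ 0 := (Real.sqrt_pos.mpr hp).ne'
    refine ⟨toE ![-u 1 / r, u 0 / r, 0], ?_, ?_⟩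
    · simp [dt3, toE]
      field_simp
      linarith
    · simp [dt3, toE]
      field_simp
      ring

/-- Moving frame: coordinates in which `u` is the third basis vector. -/
lemma exists_frame (u : R3) (hu : dt3 u u = 1) : ∃ e f : R3,
    (∀ v w, dt3 v w = dt3 v e * dt3 w e + dt3 v f * dt3 w f + dt3 v u * dt3 w u) ∧
    (∀ v w x, det3 v w x =
      dt3 v e * (dt3 w f * dt3 x u - dt3 w u * dt3 x f)
      + dt3 v f * (dt3 w u * dt3 x e - dt3 w e * dt3 x u)
      + dt3 v u * (dt3 w e * dt3 x f - dt3 w f * dt3 x e)) ∧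
    dt3 u e = 0 ∧ dt3 u f = 0 := by
  obtain ⟨e, he, hue⟩ := exists_unit_orth u
  refine ⟨e, cross3 u e, ?_, ?_, hue, ?_⟩
  · intro v w
    have key : dt3 v (cross3 u e) * dt3 w (cross3 u e) =
        dt3 v w * (dt3 u u * dt3 e e - dt3 u e * dt3 u e)
        - dt3 v u * (dt3 w u * dt3 e e - dt3 u e * dt3 w e)
        + dt3 v e * (dt3 w u * dt3 u e - dt3 u u * dt3 w e) := by
      simp only [dt3, cross3_zero, cross3_one, cross3_two]; ring
    rw [key, hu, he, hue]; ring
  · intro v w x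
    have hd : det3 e (cross3 u e) u = 1 := by
      have : det3 e (cross3 u e) u = dt3 u u * dt3 e e - dt3 u e * dt3 u e := by
        simp only [dt3, det3, cross3_zero, cross3_one, cross3_two]; ring
      rw [this, hu, he, hue]; ring
    have gram : ∀ a b c : R3, det3 v w x * det3 a b c =
      dt3 v a * (dt3 w b * dt3 x c - dt3 w c * dt3 x b)
      + dt3 v b * (dt3 w c * dt3 x a - dt3 w a * dt3 x c)
      + dt3 v c * (dt3 w a * dt3 x b - dt3 w b * dt3 x a) := by
      intro a b c
      simp only [dt3, det3]; ring
    rw [← gram, hd, mul_one]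
  · simp only [dt3, cross3_zero, cross3_one, cross3_two]; ring

/-- The algebraic identity behind conservation of the second energy, tracked for `|u₂|²`. -/
lemma alg_e2 (u0 u1 u2 u3 u4 : R3) (h0 : dt3 u0 u0 = 1) (h1 : dt3 u1 u0 = 0)
    (h2 : dt3 u2 u0 = -dt3 u1 u1) (h3 : dt3 u3 u0 = -3 * dt3 u1 u2)
    (h4 : dt3 u4 u0 = -4 * dt3 u1 u3 - 3 * dt3 u2 u2) :
    2 * (det3 u0 u4 u2 + 2 * det3 u1 u3 u2) =
      -2 * (det3 u1 u2 u3 + det3 u0 u2 u4)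
      - 2 * (2 * dt3 u1 u2 * det3 u0 u1 u2 + dt3 u1 u1 * det3 u0 u1 u3)
      + 10 * (dt3 u1 u2 * det3 u0 u1 u2) := by
  obtain ⟨e, f, hdt, hdet, he, hf⟩ := exists_frame u0 h0
  have c2 := hdt u1 u1
  have c3 := hdt u1 u2
  have c4 := hdt u1 u3
  have c5 := hdt u2 u2
  rw [h1] at c2 c3 c4
  rw [c2] at h2
  rw [c3] at h3
  rw [c4, c5] at h4
  simp only [hdet, c2, c3, h0, h1, h2, h3, h4, he, hf]
  ring

/-- The algebraic identity behind conservation of the third energy. -/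
lemma alg_e3 (u0 u1 u2 u3 u4 u5 : R3) (h0 : dt3 u0 u0 = 1) (h1 : dt3 u1 u0 = 0)
    (h2 : dt3 u2 u0 = -dt3 u1 u1) (h3 : dt3 u3 u0 = -3 * dt3 u1 u2)
    (h4 : dt3 u4 u0 = -4 * dt3 u1 u3 - 3 * dt3 u2 u2)
    (h5 : dt3 u5 u0 = -5 * dt3 u1 u4 - 10 * dt3 u2 u3) :
    2 * (det3 u0 u5 u3 + 3 * det3 u1 u4 u3)
      - 7 / 2 * (2 * det3 u0 u3 u1 * dt3 u2 u2
          + dt3 u1 u1 * (2 * (det3 u0 u4 u2 + 2 * det3 u1 u3 u2)))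
      - 14 * (2 * dt3 u1 u2 * (det3 u0 u3 u2 + (det3 u0 u4 u1)))
      + 21 / 8 * (3 * dt3 u1 u1 ^ 2 * (2 * det3 u0 u3 u1)) =
      -2 * (det3 u1 u3 u4 + det3 u0 u3 u5)
      + 7 * (2 * dt3 u1 u2 * det3 u0 u2 u3 + dt3 u1 u1 * (det3 u1 u2 u3 + det3 u0 u2 u4))
      + 16 * ((dt3 u2 u2 + dt3 u1 u3) * det3 u0 u1 u3
          + dt3 u1 u2 * (det3 u0 u2 u3 + det3 u0 u1 u4))
      + (2 * dt3 u2 u3 * det3 u0 u1 u2 + dt3 u2 u2 * det3 u0 u1 u3)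
      - 27 / 4 * (4 * dt3 u1 u1 * dt3 u1 u2 * det3 u0 u1 u2
          + dt3 u1 u1 ^ 2 * det3 u0 u1 u3) := by
  obtain ⟨e, f, hdt, hdet, he, hf⟩ := exists_frame u0 h0
  have c2 := hdt u1 u1
  have c3 := hdt u1 u2
  have c4 := hdt u1 u3
  have c5 := hdt u2 u2
  have c6 := hdt u1 u4
  have c7 := hdt u2 u3
  rw [h1] at c2 c3 c4 c6
  rw [c2] at h2
  rw [c3] at h3
  rw [h2] at c5 c7
  rw [h3] at c7
  rw [c4, c5] at h4
  rw [c6, c7] at h5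
  simp only [hdet, c2, c3, c4, c5, c7, h0, h1, h2, h3, h4, h5, he, hf]
  ring

/-- `|a·b|` and `|[u,a,b]|` are both controlled by `|a||b|`. -/
lemma dt3_det3_bound (u a b : R3) (hu : dt3 u u = 1) :
    dt3 a b ^ 2 + det3 u a b ^ 2 ≤ 2 * (dt3 a a * dt3 b b) ∧
      dt3 a b ^ 2 ≤ dt3 a a * dt3 b b := by
  obtain ⟨e, f, hdt, hdet, he, hf⟩ := exists_frame u hu
  have c1 := hdt a a
  have c2 := hdt b b
  have c3 := hdt a b
  have h2 : dt3 a b ^ 2 ≤ dt3 a a * dt3 b b := by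
    simp only [dt3]
    nlinarith [sq_nonneg (a 0 * b 1 - a 1 * b 0), sq_nonneg (a 0 * b 2 - a 2 * b 0),
      sq_nonneg (a 1 * b 2 - a 2 * b 1)]
  have h3 : det3 u a b ^ 2 ≤ dt3 a a * dt3 b b := by
    rw [hdet, c1, c2, he, hf, hu]
    generalize dt3 a e = a1
    generalize dt3 a f = a2
    generalize dt3 a u = a3
    generalize dt3 b e = b1
    generalize dt3 b f = b2
    generalize dt3 b u = b3
    have : (a1 * a1 + a2 * a2 + a3 * a3) * (b1 * b1 + b2 * b2 + b3 * b3) =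
      (a1 * b2 - a2 * b1) ^ 2 + (a1 * b1 + a2 * b2) ^ 2 + (a1 * b3) ^ 2 + (a2 * b3) ^ 2
       + (a3 * b1) ^ 2 + (a3 * b2) ^ 2 + (a3 * b3) ^ 2 := by ring
    rw [this]
    have h' : (0 * (a2 * b3 - a3 * b2) + 0 * (a3 * b1 - a1 * b3) + 1 * (a1 * b2 - a2 * b1)) ^ 2
      = (a1 * b2 - a2 * b1) ^ 2 := by ring
    rw [h']
    nlinarith [sq_nonneg (a1 * b1 + a2 * b2), sq_nonneg (a1 * b3), sq_nonneg (a2 * b3),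
      sq_nonneg (a3 * b1), sq_nonneg (a3 * b2), sq_nonneg (a3 * b3)]
  exact ⟨by linarith, h2⟩

/-! ### Derivatives of vector expressions -/

section derivs
variable {a b c : ℝ → R3} {a' b' c' : R3} {x : ℝ}

lemma hasDerivAt_coord (h : HasDerivAt a a' x) (i : Fin 3) :
    HasDerivAt (fun y => a y i) (a' i) x :=
  ((EuclideanSpace.proj i : R3 →L[ℝ] ℝ).hasFDerivAt
    (x := a x)).comp_hasDerivAt x h

lemma hasDerivAt_of_coord (h : ∀ i, HasDerivAt (fun y => a y i) (a' i) x) :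
    HasDerivAt a a' x := by
  have := hasDerivAt_pi.mpr h
  exact ((EuclideanSpace.equiv (Fin 3) ℝ).symm.toContinuousLinearMap.hasFDerivAt
    (x := fun i => a x i)).comp_hasDerivAt x this

lemma HasDerivAt.dt3 (ha : HasDerivAt a a' x) (hb : HasDerivAt b b' x) :
    HasDerivAt (fun y => dt3 (a y) (b y)) (dt3 a' (b x) + dt3 (a x) b') x := by
  have h := fun i => (hasDerivAt_coord ha i).mul (hasDerivAt_coord hb i)
  refine (((h 0).add (h 1)).add (h 2)).congr_deriv ?_
  simp only [_root_.dt3]; ring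

lemma HasDerivAt.cross3 (ha : HasDerivAt a a' x) (hb : HasDerivAt b b' x) :
    HasDerivAt (fun y => cross3 (a y) (b y)) (cross3 a' (b x) + cross3 (a x) b') x := by
  have h := fun i j => (hasDerivAt_coord ha i).mul (hasDerivAt_coord hb j)
  apply hasDerivAt_of_coord
  intro i
  fin_cases i
  · refine ((h 1 2).sub (h 2 1)).congr_deriv ?_
    simp; ring
  · refine ((h 2 0).sub (h 0 2)).congr_deriv ?_
    simp; ring
  · refine ((h 0 1).sub (h 1 0)).congr_deriv ?_
    simp; ring

lemma HasDerivAt.det3 (ha : HasDerivAt a a' x) (hb : HasDerivAt b b' x)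
    (hc : HasDerivAt c c' x) :
    HasDerivAt (fun y => det3 (a y) (b y) (c y))
      (det3 a' (b x) (c x) + det3 (a x) b' (c x) + det3 (a x) (b x) c') x := by
  have h := (ha.cross3 hb).dt3 hc
  simp only [dt3_cross_left, dt3_add_left] at h
  exact h

end derivs

lemma Smooth2.coord {F : ℝ → ℝ → R3} (hF : Smooth2 F) (i : Fin 3) :
    Smooth2 (fun t s => F t s i) :=
  (EuclideanSpace.proj i : R3 →L[ℝ] ℝ).contDiff.comp hF

lemma Smooth2.add {f g : ℝ → ℝ → ℝ} (hf : Smooth2 f) (hg : Smooth2 g) :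
    Smooth2 (fun t s => f t s + g t s) := ContDiff.add hf hg
lemma Smooth2.sub {f g : ℝ → ℝ → ℝ} (hf : Smooth2 f) (hg : Smooth2 g) :
    Smooth2 (fun t s => f t s - g t s) := ContDiff.sub hf hg
lemma Smooth2.mul {f g : ℝ → ℝ → ℝ} (hf : Smooth2 f) (hg : Smooth2 g) :
    Smooth2 (fun t s => f t s * g t s) := ContDiff.mul hf hg
lemma Smooth2.pow {f : ℝ → ℝ → ℝ} (hf : Smooth2 f) (n : ℕ) :
    Smooth2 (fun t s => f t s ^ n) := ContDiff.pow hf n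
lemma Smooth2.cmul {f : ℝ → ℝ → ℝ} (k : ℝ) (hf : Smooth2 f) :
    Smooth2 (fun t s => k * f t s) := ContDiff.mul contDiff_const hf
lemma Smooth2.zero : Smooth2 (fun _ _ => (0 : ℝ)) := contDiff_const

lemma Smooth2.dt3 {F G : ℝ → ℝ → R3} (hF : Smooth2 F) (hG : Smooth2 G) :
    Smooth2 (fun t s => dt3 (F t s) (G t s)) :=
  (((hF.coord 0).mul (hG.coord 0)).add ((hF.coord 1).mul (hG.coord 1))).add
    ((hF.coord 2).mul (hG.coord 2))

lemma Smooth2.det3 {F G H : ℝ → ℝ → R3} (hF : Smooth2 F) (hG : Smooth2 G) (hH : Smooth2 H) :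
    Smooth2 (fun t s => det3 (F t s) (G t s) (H t s)) :=
  (((hF.coord 0).mul (((hG.coord 1).mul (hH.coord 2)).sub ((hG.coord 2).mul (hH.coord 1)))).add
    ((hF.coord 1).mul (((hG.coord 2).mul (hH.coord 0)).sub ((hG.coord 0).mul (hH.coord 2))))).add
    ((hF.coord 2).mul (((hG.coord 0).mul (hH.coord 1)).sub ((hG.coord 1).mul (hH.coord 0))))

/-! ### The Schrödinger map flow -/

lemma det3_self12 (a b : R3) : det3 a a b = 0 := by simp only [det3]; ring
lemma det3_self13 (a b : R3) : det3 a b a = 0 := by simp only [det3]; ring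
lemma det3_self23 (a b : R3) : det3 a b b = 0 := by simp only [det3]; ring

/-- Iterated space derivatives. -/
def VV (u : ℝ → ℝ → R3) : ℕ → ℝ → ℝ → R3
  | 0 => u
  | k + 1 => fun t => deriv (VV u k t)

/-- Hypotheses on the flow. -/
structure IsFlow (ℓ : ℝ) (u : ℝ → ℝ → R3) : Prop where
  smooth : Smooth2 u
  per : ∀ t s : ℝ, u t (s + ℓ) = u t s
  unit : ∀ t s : ℝ, ‖u t s‖ = 1
  eqn : ∀ t s : ℝ, deriv (fun τ => u τ s) t = deriv (fun σ => cross3 (u t σ) (deriv (u t) σ)) s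

namespace IsFlow
variable {ℓ : ℝ} {u : ℝ → ℝ → R3} (h : IsFlow ℓ u)
include h

lemma sm (k : ℕ) : Smooth2 (VV u k) := by
  induction k with
  | zero => exact h.smooth
  | succ k ih => exact ih.deriv_right

lemma ds (k : ℕ) (t s : ℝ) : HasDerivAt (VV u k t) (VV u (k + 1) t s) s :=
  (h.sm k).hasDerivAt_right t s

lemma perV (k : ℕ) (t s : ℝ) : VV u k t (s + ℓ) = VV u k t s := by
  induction k generalizing s with
  | zero => exact h.per t s
  | succ k ih =>
    have : (fun x => VV u k t (x + ℓ)) = VV u k t := funext ih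
    change deriv (VV u k t) (s + ℓ) = deriv (VV u k t) s
    rw [← deriv_comp_add_const, this]

lemma perV0 (k : ℕ) (t : ℝ) : VV u k t ℓ = VV u k t 0 := by
  have := h.perV k t 0
  rwa [zero_add] at this

lemma c0 (t s : ℝ) : dt3 (VV u 0 t s) (VV u 0 t s) = 1 := by
  rw [← norm_sq_eq_dt3]
  change ‖u t s‖ ^ 2 = 1
  rw [h.unit]; norm_num

lemma c1 (t s : ℝ) : dt3 (VV u 1 t s) (VV u 0 t s) = 0 := by
  have h1 := (h.ds 0 t s).dt3 (h.ds 0 t s)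
  have h2 : (fun y => dt3 (VV u 0 t y) (VV u 0 t y)) = fun _ => 1 := funext (h.c0 t)
  rw [h2] at h1
  have := h1.unique (hasDerivAt_const s 1)
  rw [dt3_comm (VV u 0 t s)] at this
  simp only [zero_add] at this
  linarith

lemma c2 (t s : ℝ) : dt3 (VV u 2 t s) (VV u 0 t s) = -dt3 (VV u 1 t s) (VV u 1 t s) := by
  have h1 := (h.ds 1 t s).dt3 (h.ds 0 t s)
  have h2 : (fun y => dt3 (VV u 1 t y) (VV u 0 t y)) = fun _ => 0 := funext (h.c1 t)
  rw [h2] at h1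
  have := h1.unique (hasDerivAt_const s 0)
  simp only [zero_add, Nat.reduceAdd] at this
  linarith

lemma c3 (t s : ℝ) : dt3 (VV u 3 t s) (VV u 0 t s) = -3 * dt3 (VV u 1 t s) (VV u 2 t s) := by
  have h1 := (h.ds 2 t s).dt3 (h.ds 0 t s)
  have h2 : (fun y => dt3 (VV u 2 t y) (VV u 0 t y)) =
    fun y => -dt3 (VV u 1 t y) (VV u 1 t y) := funext (h.c2 t)
  rw [h2] at h1
  have := h1.unique ((h.ds 1 t s).dt3 (h.ds 1 t s)).neg
  simp only [zero_add, Nat.reduceAdd, dt3_comm (VV u 2 t s) (VV u 1 t s)] at this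
  linarith

lemma c4 (t s : ℝ) : dt3 (VV u 4 t s) (VV u 0 t s) =
    -4 * dt3 (VV u 1 t s) (VV u 3 t s) - 3 * dt3 (VV u 2 t s) (VV u 2 t s) := by
  have h1 := (h.ds 3 t s).dt3 (h.ds 0 t s)
  have h2 : (fun y => dt3 (VV u 3 t y) (VV u 0 t y)) =
    fun y => -3 * dt3 (VV u 1 t y) (VV u 2 t y) := funext (h.c3 t)
  rw [h2] at h1
  have := h1.unique (((h.ds 1 t s).dt3 (h.ds 2 t s)).const_mul (-3))
  simp only [zero_add, Nat.reduceAdd, dt3_comm (VV u 3 t s) (VV u 1 t s)] at this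
  linarith

lemma c5 (t s : ℝ) : dt3 (VV u 5 t s) (VV u 0 t s) =
    -5 * dt3 (VV u 1 t s) (VV u 4 t s) - 10 * dt3 (VV u 2 t s) (VV u 3 t s) := by
  have h1 := (h.ds 4 t s).dt3 (h.ds 0 t s)
  have h2 : (fun y => dt3 (VV u 4 t y) (VV u 0 t y)) =
    fun y => -4 * dt3 (VV u 1 t y) (VV u 3 t y) - 3 * dt3 (VV u 2 t y) (VV u 2 t y) :=
      funext (h.c4 t)
  rw [h2] at h1
  have := h1.unique ((((h.ds 1 t s).dt3 (h.ds 3 t s)).const_mul (-4)).sub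
    (((h.ds 2 t s).dt3 (h.ds 2 t s)).const_mul 3))
  simp only [zero_add, Nat.reduceAdd, dt3_comm (VV u 4 t s) (VV u 1 t s),
    dt3_comm (VV u 3 t s) (VV u 2 t s)] at this
  linarith

lemma t0 (t s : ℝ) : HasDerivAt (fun τ => VV u 0 τ s) (cross3 (VV u 0 t s) (VV u 2 t s)) t := by
  have h1 := h.smooth.hasDerivAt_left t s
  rw [h.eqn] at h1
  have h2 := ((h.ds 0 t s).cross3 (h.ds 1 t s)).deriv
  refine h1.congr_deriv (h2.trans ?_)
  ext i; fin_cases i <;> simp <;> ring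

lemma t1 (t s : ℝ) : HasDerivAt (fun τ => VV u 1 τ s)
    (cross3 (VV u 0 t s) (VV u 3 t s) + cross3 (VV u 1 t s) (VV u 2 t s)) t := by
  refine (h.sm 0).hasDerivAt_swap h.t0 ?_
  refine ((h.ds 0 t s).cross3 (h.ds 2 t s)).congr_deriv ?_
  rw [add_comm]

lemma t2 (t s : ℝ) : HasDerivAt (fun τ => VV u 2 τ s)
    (cross3 (VV u 0 t s) (VV u 4 t s) + (2 : ℝ) • cross3 (VV u 1 t s) (VV u 3 t s)) t := by
  refine (h.sm 1).hasDerivAt_swap h.t1 ?_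
  refine (((h.ds 0 t s).cross3 (h.ds 3 t s)).add
    ((h.ds 1 t s).cross3 (h.ds 2 t s))).congr_deriv ?_
  ext i; fin_cases i <;> simp <;> ring

lemma t3 (t s : ℝ) : HasDerivAt (fun τ => VV u 3 τ s)
    (cross3 (VV u 0 t s) (VV u 5 t s) + (3 : ℝ) • cross3 (VV u 1 t s) (VV u 4 t s)
      + (2 : ℝ) • cross3 (VV u 2 t s) (VV u 3 t s)) t := by
  refine (h.sm 2).hasDerivAt_swap h.t2 ?_
  refine (((h.ds 0 t s).cross3 (h.ds 4 t s)).add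
    (((h.ds 1 t s).cross3 (h.ds 3 t s)).const_smul (2 : ℝ))).congr_deriv ?_
  ext i; fin_cases i <;> simp <;> ring

/-! Time derivatives of the densities. -/

lemma p11t (t s : ℝ) : HasDerivAt (fun τ => dt3 (VV u 1 τ s) (VV u 1 τ s))
    (2 * det3 (VV u 0 t s) (VV u 3 t s) (VV u 1 t s)) t := by
  refine ((h.t1 t s).dt3 (h.t1 t s)).congr_deriv ?_
  simp only [dt3_add_left, dt3_add_right, dt3_cross_left, dt3_cross_right, det3_self13]
  ring

lemma p12t (t s : ℝ) : HasDerivAt (fun τ => dt3 (VV u 1 τ s) (VV u 2 τ s))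
    (det3 (VV u 0 t s) (VV u 3 t s) (VV u 2 t s)
      + det3 (VV u 0 t s) (VV u 4 t s) (VV u 1 t s)) t := by
  refine ((h.t1 t s).dt3 (h.t2 t s)).congr_deriv ?_
  simp only [dt3_add_left, dt3_add_right, dt3_smul_left, dt3_smul_right,
    dt3_cross_left, dt3_cross_right, det3_self13, det3_self23]
  ring

lemma p22t (t s : ℝ) : HasDerivAt (fun τ => dt3 (VV u 2 τ s) (VV u 2 τ s))
    (2 * (det3 (VV u 0 t s) (VV u 4 t s) (VV u 2 t s)
      + 2 * det3 (VV u 1 t s) (VV u 3 t s) (VV u 2 t s))) t := by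
  refine ((h.t2 t s).dt3 (h.t2 t s)).congr_deriv ?_
  simp only [dt3_add_left, dt3_add_right, dt3_smul_left, dt3_smul_right,
    dt3_cross_left, dt3_cross_right, det3_self13, det3_self23]
  ring

lemma p33t (t s : ℝ) : HasDerivAt (fun τ => dt3 (VV u 3 τ s) (VV u 3 τ s))
    (2 * (det3 (VV u 0 t s) (VV u 5 t s) (VV u 3 t s)
      + 3 * det3 (VV u 1 t s) (VV u 4 t s) (VV u 3 t s))) t := by
  refine ((h.t3 t s).dt3 (h.t3 t s)).congr_deriv ?_
  simp only [dt3_add_left, dt3_add_right, dt3_smul_left, dt3_smul_right,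
    dt3_cross_left, dt3_cross_right, det3_self13, det3_self23]
  ring

/-! Space derivatives of dot and triple products. -/

lemma pds (i j : ℕ) (t s : ℝ) : HasDerivAt (fun σ => dt3 (VV u i t σ) (VV u j t σ))
    (dt3 (VV u (i + 1) t s) (VV u j t s) + dt3 (VV u i t s) (VV u (j + 1) t s)) s :=
  (h.ds i t s).dt3 (h.ds j t s)

lemma wds (i j : ℕ) (t s : ℝ) : HasDerivAt (fun σ => det3 (VV u 0 t σ) (VV u i t σ) (VV u j t σ))
    (det3 (VV u 1 t s) (VV u i t s) (VV u j t s)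
      + det3 (VV u 0 t s) (VV u (i + 1) t s) (VV u j t s)
      + det3 (VV u 0 t s) (VV u i t s) (VV u (j + 1) t s)) s :=
  (h.ds 0 t s).det3 (h.ds i t s) (h.ds j t s)

lemma psm (i j : ℕ) : Smooth2 (fun t s => dt3 (VV u i t s) (VV u j t s)) :=
  (h.sm i).dt3 (h.sm j)

lemma wsm (i j : ℕ) : Smooth2 (fun t s => det3 (VV u 0 t s) (VV u i t s) (VV u j t s)) :=
  (h.sm 0).det3 (h.sm i) (h.sm j)

/-- Conservation of the first energy. -/
lemma e1 (t : ℝ) : HasDerivAt (fun τ => ∫ s in (0 : ℝ)..ℓ, dt3 (VV u 1 τ s) (VV u 1 τ s)) 0 t := by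
  have := (h.psm 1 1).hasDerivAt_integral_flux (ℓ := ℓ) ((h.wsm 1 2).cmul (-2)) Smooth2.zero
    (fun t => by simp only [h.perV0]) (fun t s => (h.wds 1 2 t s).const_mul (-2))
    (fun t s => (h.p11t t s).congr_deriv ?_) t
  · simpa using this
  · simp only [det3_self12, det3_self23, Nat.reduceAdd]
    simp only [det3]; ring

/-- Derivative of `∫ |u₁|⁴`. -/
lemma e14 (t : ℝ) : HasDerivAt (fun τ => ∫ s in (0 : ℝ)..ℓ, dt3 (VV u 1 τ s) (VV u 1 τ s) ^ 2)
    (∫ s in (0 : ℝ)..ℓ, 8 * (dt3 (VV u 1 t s) (VV u 2 t s)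
      * det3 (VV u 0 t s) (VV u 1 t s) (VV u 2 t s))) t := by
  refine ((h.psm 1 1).pow 2).hasDerivAt_integral_flux (ℓ := ℓ)
    (((h.psm 1 1).mul (h.wsm 1 2)).cmul (-4)) (((h.psm 1 2).mul (h.wsm 1 2)).cmul 8)
    (fun t => by simp only [h.perV0])
    (fun t s => ((h.pds 1 1 t s).mul (h.wds 1 2 t s)).const_mul (-4))
    (fun t s => ((h.p11t t s).pow 2).congr_deriv ?_) t
  simp only [det3_self12, det3_self23, Nat.reduceAdd, dt3_comm (VV u 2 t s) (VV u 1 t s)]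
  have : det3 (VV u 0 t s) (VV u 3 t s) (VV u 1 t s) =
    - det3 (VV u 0 t s) (VV u 1 t s) (VV u 3 t s) := by simp only [det3]; ring
  rw [this]
  push_cast
  ring

/-- Derivative of `∫ |u₂|²`. -/
lemma e22 (t : ℝ) : HasDerivAt (fun τ => ∫ s in (0 : ℝ)..ℓ, dt3 (VV u 2 τ s) (VV u 2 τ s))
    (∫ s in (0 : ℝ)..ℓ, 10 * (dt3 (VV u 1 t s) (VV u 2 t s)
      * det3 (VV u 0 t s) (VV u 1 t s) (VV u 2 t s))) t := by
  refine (h.psm 2 2).hasDerivAt_integral_flux (ℓ := ℓ)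
    (((h.wsm 2 3).cmul (-2)).sub (((h.psm 1 1).mul (h.wsm 1 2)).cmul 2))
    (((h.psm 1 2).mul (h.wsm 1 2)).cmul 10)
    (fun t => by simp only [h.perV0])
    (fun t s => ((h.wds 2 3 t s).const_mul (-2)).sub
      (((h.pds 1 1 t s).mul (h.wds 1 2 t s)).const_mul 2))
    (fun t s => (h.p22t t s).congr_deriv ?_) t
  simp only [det3_self12, det3_self23, Nat.reduceAdd, dt3_comm (VV u 2 t s) (VV u 1 t s)]
  linear_combination alg_e2 _ _ _ _ _ (h.c0 t s) (h.c1 t s) (h.c2 t s) (h.c3 t s) (h.c4 t s)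

/-- Conservation of the third energy. -/
lemma e3 (t : ℝ) : HasDerivAt (fun τ => ∫ s in (0 : ℝ)..ℓ,
    (dt3 (VV u 3 τ s) (VV u 3 τ s)
      - 7 / 2 * (dt3 (VV u 1 τ s) (VV u 1 τ s) * dt3 (VV u 2 τ s) (VV u 2 τ s))
      - 14 * dt3 (VV u 1 τ s) (VV u 2 τ s) ^ 2
      + 21 / 8 * dt3 (VV u 1 τ s) (VV u 1 τ s) ^ 3)) 0 t := by
  have := ((((h.psm 3 3).sub (((h.psm 1 1).mul (h.psm 2 2)).cmul (7 / 2))).sub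
      (((h.psm 1 2).pow 2).cmul 14)).add
      (((h.psm 1 1).pow 3).cmul (21 / 8))).hasDerivAt_integral_flux (ℓ := ℓ)
    ((((((h.wsm 3 4).cmul (-2)).add (((h.psm 1 1).mul (h.wsm 2 3)).cmul 7)).add
      (((h.psm 1 2).mul (h.wsm 1 3)).cmul 16)).add
      ((h.psm 2 2).mul (h.wsm 1 2))).sub
      ((((h.psm 1 1).pow 2).mul (h.wsm 1 2)).cmul (27 / 4)))
    Smooth2.zero
    (fun t => by simp only [h.perV0])
    (fun t s => ((((((h.wds 3 4 t s).const_mul (-2)).add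
      (((h.pds 1 1 t s).mul (h.wds 2 3 t s)).const_mul 7)).add
      (((h.pds 1 2 t s).mul (h.wds 1 3 t s)).const_mul 16)).add
      ((h.pds 2 2 t s).mul (h.wds 1 2 t s))).sub
      ((((h.pds 1 1 t s).pow 2).mul (h.wds 1 2 t s)).const_mul (27 / 4))))
    (fun t s => ((((h.p33t t s).sub (((h.p11t t s).mul (h.p22t t s)).const_mul (7 / 2))).sub
      (((h.p12t t s).pow 2).const_mul 14)).add
      (((h.p11t t s).pow 3).const_mul (21 / 8))).congr_deriv ?_) t
  · simpa using this
  · simp only [det3_self12, det3_self23, Nat.reduceAdd, dt3_comm (VV u 2 t s) (VV u 1 t s),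
      dt3_comm (VV u 3 t s) (VV u 2 t s)]
    push_cast
    simp only [Pi.pow_apply]
    linear_combination alg_e3 _ _ _ _ _ _ (h.c0 t s) (h.c1 t s) (h.c2 t s) (h.c3 t s) (h.c4 t s)
      (h.c5 t s)

end IsFlow

/-! ### Inequalities -/

lemma cs_integral {f g : ℝ → ℝ} (hf : Continuous f) (hg : Continuous g) {ℓ : ℝ} (hℓ : 0 < ℓ) :
    (∫ s in (0 : ℝ)..ℓ, f s * g s) ^ 2 ≤
      (∫ s in (0 : ℝ)..ℓ, f s ^ 2) * ∫ s in (0 : ℝ)..ℓ, g s ^ 2 := by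
  have key : ∀ x : ℝ, 0 ≤ (∫ s in (0 : ℝ)..ℓ, g s ^ 2) * (x * x)
      + (-2 * ∫ s in (0 : ℝ)..ℓ, f s * g s) * x + ∫ s in (0 : ℝ)..ℓ, f s ^ 2 := by
    intro x
    have h0 : 0 ≤ ∫ s in (0 : ℝ)..ℓ, (f s - x * g s) ^ 2 :=
      intervalIntegral.integral_nonneg hℓ.le fun s _ => sq_nonneg _
    have h1 : (∫ s in (0 : ℝ)..ℓ, (f s - x * g s) ^ 2) =
        ∫ s in (0 : ℝ)..ℓ, ((x * x) * g s ^ 2 + (-2 * x) * (f s * g s) + f s ^ 2) := by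
      congr 1; funext s; ring
    rw [h1, intervalIntegral.integral_add, intervalIntegral.integral_add,
      intervalIntegral.integral_const_mul, intervalIntegral.integral_const_mul] at h0
    · linarith
    all_goals exact Continuous.intervalIntegrable (by fun_prop) _ _
  have := discrim_le_zero key
  unfold discrim at this
  nlinarith

namespace IsFlow
variable {ℓ : ℝ} {u : ℝ → ℝ → R3} (h : IsFlow ℓ u)
include h

lemma pc (i j : ℕ) (t : ℝ) : Continuous (fun s => dt3 (VV u i t s) (VV u j t s)) :=
  (h.psm i j).continuous_right t
lemma wc (i j : ℕ) (t : ℝ) :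
    Continuous (fun s => det3 (VV u 0 t s) (VV u i t s) (VV u j t s)) :=
  (h.wsm i j).continuous_right t
lemma nc (i : ℕ) (t : ℝ) : Continuous (fun s => ‖VV u i t s‖) :=
  ((h.sm i).continuous_right t).norm

lemma abs_p (i j : ℕ) (t s : ℝ) :
    |dt3 (VV u i t s) (VV u j t s)| ≤ ‖VV u i t s‖ * ‖VV u j t s‖ := by
  apply abs_le_of_sq_le_sq _ (by positivity)
  rw [mul_pow, norm_sq_eq_dt3, norm_sq_eq_dt3]
  exact (dt3_det3_bound _ _ _ (h.c0 t s)).2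

lemma dt3_sub_bound (a b : R3) {K : ℝ} (ha : ‖a‖ ≤ K) : -dt3 a b ≤ K * ‖b‖ := by
  have h1 : |dt3 a b| ≤ ‖a‖ * ‖b‖ := by
    apply abs_le_of_sq_le_sq _ (by positivity)
    rw [mul_pow, norm_sq_eq_dt3, norm_sq_eq_dt3]
    simp only [dt3]
    nlinarith [sq_nonneg (a 0 * b 1 - a 1 * b 0), sq_nonneg (a 0 * b 2 - a 2 * b 0),
      sq_nonneg (a 1 * b 2 - a 2 * b 1)]
  have h2 : ‖a‖ * ‖b‖ ≤ K * ‖b‖ := by gcongr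
  linarith [neg_abs_le (dt3 a b)]

/-- Integration by parts bound. -/
lemma n1_le (hℓ : 0 < ℓ) (t : ℝ) {K : ℝ}
    (hK : ∀ s ∈ Set.Icc 0 ℓ, ‖VV u 0 t s - VV u 0 t 0‖ ≤ K) :
    (∫ s in (0 : ℝ)..ℓ, dt3 (VV u 1 t s) (VV u 1 t s)) ≤
      K * ∫ s in (0 : ℝ)..ℓ, ‖VV u 2 t s‖ := by
  have hd : ∀ s, HasDerivAt (fun σ => dt3 (VV u 0 t σ - VV u 0 t 0) (VV u 1 t σ))
      (dt3 (VV u 1 t s) (VV u 1 t s) + dt3 (VV u 0 t s - VV u 0 t 0) (VV u 2 t s)) s :=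
    fun s => ((h.ds 0 t s).sub_const (VV u 0 t 0)).dt3 (h.ds 1 t s)
  have hcV := fun i => (h.sm i).continuous_right t
  have hc2 : Continuous fun s => dt3 (VV u 0 t s - VV u 0 t 0) (VV u 2 t s) := by
    have h0 := hcV 0
    have h2 := hcV 2
    unfold dt3
    fun_prop
  have hc1 := h.pc 1 1 t
  have hint := intervalIntegral.integral_eq_sub_of_hasDerivAt (a := 0) (b := ℓ)
    (fun s _ => hd s) ((hc1.add hc2).intervalIntegrable _ _)
  rw [h.perV0 0, h.perV0 1, sub_self, intervalIntegral.integral_add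
    (hc1.intervalIntegrable _ _) (hc2.intervalIntegrable _ _)] at hint
  have h1 : (∫ s in (0 : ℝ)..ℓ, dt3 (VV u 1 t s) (VV u 1 t s)) =
      ∫ s in (0 : ℝ)..ℓ, -dt3 (VV u 0 t s - VV u 0 t 0) (VV u 2 t s) := by
    rw [intervalIntegral.integral_neg]; linarith
  rw [h1, ← intervalIntegral.integral_const_mul]
  refine intervalIntegral.integral_mono_on hℓ.le (hc2.neg.intervalIntegrable _ _)
    (((h.nc 2 t).const_mul K).intervalIntegrable _ _) fun s hs => ?_
  exact h.dt3_sub_bound _ _ (hK s hs)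

lemma int_norm_sq (i : ℕ) (t : ℝ) : (∫ s in (0 : ℝ)..ℓ, ‖VV u i t s‖ ^ 2) =
    ∫ s in (0 : ℝ)..ℓ, dt3 (VV u i t s) (VV u i t s) := by
  congr 1; funext s; exact norm_sq_eq_dt3 _

lemma int_norm_le (hℓ : 0 < ℓ) (i : ℕ) (t : ℝ) : (∫ s in (0 : ℝ)..ℓ, ‖VV u i t s‖) ^ 2 ≤
    ℓ * ∫ s in (0 : ℝ)..ℓ, dt3 (VV u i t s) (VV u i t s) := by
  have := cs_integral (continuous_const (y := (1 : ℝ))) (h.nc i t) hℓ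
  rw [h.int_norm_sq] at this
  simpa using this

lemma n_nonneg (hℓ : 0 < ℓ) (i : ℕ) (t : ℝ) :
    0 ≤ ∫ s in (0 : ℝ)..ℓ, dt3 (VV u i t s) (VV u i t s) := by
  rw [← h.int_norm_sq]
  exact intervalIntegral.integral_nonneg hℓ.le fun s _ => sq_nonneg _

/-- First Poincaré type inequality. -/
lemma poin1 (hℓ : 0 < ℓ) (t : ℝ) :
    (∫ s in (0 : ℝ)..ℓ, dt3 (VV u 1 t s) (VV u 1 t s)) ^ 2 ≤
      4 * ℓ * ∫ s in (0 : ℝ)..ℓ, dt3 (VV u 2 t s) (VV u 2 t s) := by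
  have h1 := h.n1_le hℓ t (K := 2) (fun s _ => by
    have := norm_sub_le (VV u 0 t s) (VV u 0 t 0)
    have e1 : ‖VV u 0 t s‖ = 1 := h.unit t s
    have e2 : ‖VV u 0 t 0‖ = 1 := h.unit t 0
    linarith)
  have h2 := h.int_norm_le hℓ 2 t
  have h3 := h.n_nonneg hℓ 1 t
  nlinarith

/-- Second Poincaré type inequality. -/
lemma poin2 (hℓ : 0 < ℓ) (t : ℝ) :
    (∫ s in (0 : ℝ)..ℓ, dt3 (VV u 1 t s) (VV u 1 t s)) ≤
      ℓ ^ 2 * ∫ s in (0 : ℝ)..ℓ, dt3 (VV u 2 t s) (VV u 2 t s) := by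
  have hc := h.nc 1 t
  have h1 := h.n1_le hℓ t (K := ∫ s in (0 : ℝ)..ℓ, ‖VV u 1 t s‖) (fun s hs => by
    have hi : (∫ x in (0 : ℝ)..s, VV u 1 t x) = VV u 0 t s - VV u 0 t 0 :=
      intervalIntegral.integral_eq_sub_of_hasDerivAt (fun x _ => h.ds 0 t x)
        (((h.sm 1).continuous_right t).intervalIntegrable _ _)
    rw [← hi]
    refine (intervalIntegral.norm_integral_le_integral_norm hs.1).trans ?_
    exact intervalIntegral.integral_mono_interval le_rfl hs.1 hs.2
      (Filter.Eventually.of_forall fun x => norm_nonneg _) (hc.intervalIntegrable _ _))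
  have h2 := h.int_norm_le hℓ 2 t
  have h3 := h.n_nonneg hℓ 1 t
  have h4 := h.int_norm_le hℓ 1 t
  have h5 := h.n_nonneg hℓ 2 t
  set N1 := ∫ s in (0 : ℝ)..ℓ, dt3 (VV u 1 t s) (VV u 1 t s)
  set N2 := ∫ s in (0 : ℝ)..ℓ, dt3 (VV u 2 t s) (VV u 2 t s)
  set A := ∫ s in (0 : ℝ)..ℓ, ‖VV u 1 t s‖
  set B := ∫ s in (0 : ℝ)..ℓ, ‖VV u 2 t s‖
  have h6 : N1 ^ 2 ≤ (ℓ * N1) * (ℓ * N2) := by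
    calc N1 ^ 2 ≤ (A * B) ^ 2 := by gcongr
      _ = A ^ 2 * B ^ 2 := by ring
      _ ≤ _ := by gcongr
  rcases h3.eq_or_lt with h0 | h0
  · rw [← h0]; positivity
  · have : N1 * N1 ≤ N1 * (ℓ ^ 2 * N2) := by nlinarith
    exact le_of_mul_le_mul_left this h0

/-- Sup bound. -/
lemma sup_bound (hℓ : 0 < ℓ) (t : ℝ) {s : ℝ} (hs : s ∈ Set.Icc 0 ℓ) :
    dt3 (VV u 1 t s) (VV u 1 t s) ≤
      3 * (√(∫ s in (0 : ℝ)..ℓ, dt3 (VV u 1 t s) (VV u 1 t s))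
        * √(∫ s in (0 : ℝ)..ℓ, dt3 (VV u 2 t s) (VV u 2 t s))) := by
  set P := ∫ x in (0 : ℝ)..ℓ, ‖VV u 1 t x‖ * ‖VV u 2 t x‖ with hP
  have hPc : Continuous fun x => ‖VV u 1 t x‖ * ‖VV u 2 t x‖ := (h.nc 1 t).mul (h.nc 2 t)
  have h1 : ∀ y ∈ Set.Icc 0 ℓ, dt3 (VV u 1 t s) (VV u 1 t s) - 2 * P ≤
      dt3 (VV u 1 t y) (VV u 1 t y) := by
    intro y hy
    have hi : (∫ x in y..s, 2 * dt3 (VV u 1 t x) (VV u 2 t x)) =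
        dt3 (VV u 1 t s) (VV u 1 t s) - dt3 (VV u 1 t y) (VV u 1 t y) :=
      intervalIntegral.integral_eq_sub_of_hasDerivAt
        (fun x _ => (h.pds 1 1 t x).congr_deriv (by
          rw [dt3_comm (VV u (1 + 1) t x)]; ring))
        (((h.pc 1 2 t).const_mul 2).intervalIntegrable _ _)
    have hb : ‖∫ x in y..s, 2 * dt3 (VV u 1 t x) (VV u 2 t x)‖ ≤ 2 * P := by
      rw [hP, ← intervalIntegral.integral_const_mul]
      refine (intervalIntegral.norm_integral_le_abs_integral_norm).trans ?_
      rw [intervalIntegral.abs_integral_eq_abs_integral_uIoc,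
        abs_of_nonneg (setIntegral_nonneg measurableSet_uIoc fun x _ => norm_nonneg _),
        intervalIntegral.integral_of_le hℓ.le]
      have hsub : Set.uIoc y s ⊆ Set.Ioc 0 ℓ := by
        intro x hx
        exact ⟨lt_of_le_of_lt (le_min hy.1 hs.1) hx.1, hx.2.trans (max_le hy.2 hs.2)⟩
      refine (setIntegral_mono_on ?_ ?_ measurableSet_uIoc (g := fun x =>
        2 * (‖VV u 1 t x‖ * ‖VV u 2 t x‖)) ?_).trans
        (setIntegral_mono_set ?_ ?_ (Filter.Eventually.of_forall hsub))
      · exact (((h.pc 1 2 t).const_mul 2).norm.intervalIntegrable _ _).def'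
      · exact ((hPc.const_mul 2).intervalIntegrable _ _).def'
      · intro x _
        rw [norm_mul, Real.norm_eq_abs, Real.norm_eq_abs, abs_two]
        have := h.abs_p 1 2 t x
        linarith
      · exact (intervalIntegrable_iff_integrableOn_Ioc_of_le hℓ.le).1
          ((hPc.const_mul 2).intervalIntegrable _ _)
      · exact Filter.Eventually.of_forall fun x => by positivity
    rw [hi, Real.norm_eq_abs] at hb
    linarith [le_abs_self (dt3 (VV u 1 t s) (VV u 1 t s) - dt3 (VV u 1 t y) (VV u 1 t y))]
  have h2 := intervalIntegral.integral_mono_on (μ := volume) hℓ.le intervalIntegrable_const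
    ((h.pc 1 1 t).intervalIntegrable _ _) h1
  rw [intervalIntegral.integral_const, sub_zero, smul_eq_mul] at h2
  have h3 : P ^ 2 ≤ _ := cs_integral (h.nc 1 t) (h.nc 2 t) hℓ
  rw [h.int_norm_sq, h.int_norm_sq] at h3
  have h4 := h.poin2 hℓ t
  have n1 := h.n_nonneg hℓ 1 t
  have n2 := h.n_nonneg hℓ 2 t
  set N1 := ∫ s in (0 : ℝ)..ℓ, dt3 (VV u 1 t s) (VV u 1 t s)
  set N2 := ∫ s in (0 : ℝ)..ℓ, dt3 (VV u 2 t s) (VV u 2 t s)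
  have ha := Real.sq_sqrt n1
  have hb := Real.sq_sqrt n2
  have ha0 := Real.sqrt_nonneg N1
  have hb0 := Real.sqrt_nonneg N2
  set a := √N1
  set b := √N2
  have h5 : P ≤ a * b := by
    apply le_of_sq_le_sq _ (by positivity)
    rw [mul_pow, ha, hb]; exact h3
  have h6 : a ≤ ℓ * b := by
    apply le_of_sq_le_sq _ (by positivity)
    rw [mul_pow, ha, hb]; exact h4
  have h7 : ℓ * (dt3 (VV u 1 t s) (VV u 1 t s)) ≤ ℓ * (3 * (a * b)) := by
    have h8 : N1 ≤ ℓ * (a * b) := by rw [← ha]; nlinarith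
    have h9 : ℓ * P ≤ ℓ * (a * b) := by gcongr
    nlinarith
  exact le_of_mul_le_mul_left h7 hℓ

end IsFlow

/-- A two-sided linear Grönwall inequality. -/
lemma gronwall_two {f f' : ℝ → ℝ} {κ : ℝ} (hf : ∀ t, HasDerivAt f (f' t) t)
    (hb : ∀ t, |f' t| ≤ κ * f t) (t : ℝ) : f t ≤ f 0 * exp (κ * |t|) := by
  have hexp : ∀ (k x : ℝ), HasDerivAt (fun y => exp (k * y)) (exp (k * x) * k) x := by
    intro k x
    simpa using ((hasDerivAt_id x).const_mul k).exp
  rcases le_total 0 t with ht | ht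
  · have hm : Antitone fun x => f x * exp (-κ * x) :=
      antitone_of_hasDerivAt_nonpos (fun x => (hf x).mul (hexp (-κ) x)) fun x => by
        have := (abs_le.1 (hb x)).2
        have := Real.exp_pos (-κ * x)
        simp only [Pi.zero_apply]
        nlinarith
    have := hm ht
    simp only [mul_zero, Real.exp_zero, mul_one] at this
    rw [abs_of_nonneg ht]
    calc f t = (f t * exp (-κ * t)) * exp (κ * t) := by
          rw [mul_assoc, ← Real.exp_add]; simp
      _ ≤ _ := by gcongr
  · have hm : Monotone fun x => f x * exp (κ * x) :=
      monotone_of_hasDerivAt_nonneg (fun x => (hf x).mul (hexp κ x)) fun x => by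
        have := (abs_le.1 (hb x)).1
        have := Real.exp_pos (κ * x)
        simp only [Pi.zero_apply]
        nlinarith
    have := hm ht
    simp only [mul_zero, Real.exp_zero, mul_one] at this
    rw [abs_of_nonpos ht]
    calc f t = (f t * exp (κ * t)) * exp (κ * -t) := by
          rw [mul_assoc, ← Real.exp_add]; simp
      _ ≤ _ := by gcongr

namespace IsFlow
variable {ℓ : ℝ} {u : ℝ → ℝ → R3} (h : IsFlow ℓ u)
include h

lemma p_nonneg (i : ℕ) (t s : ℝ) : 0 ≤ dt3 (VV u i t s) (VV u i t s) := by
  rw [← norm_sq_eq_dt3]; positivity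

lemma n1_const (t : ℝ) : (∫ s in (0 : ℝ)..ℓ, dt3 (VV u 1 t s) (VV u 1 t s)) =
    ∫ s in (0 : ℝ)..ℓ, dt3 (VV u 1 0 s) (VV u 1 0 s) :=
  is_const_of_deriv_eq_zero (fun t => (h.e1 t).differentiableAt) (fun t => (h.e1 t).deriv) t 0

lemma e2_const (t : ℝ) : (∫ s in (0 : ℝ)..ℓ, dt3 (VV u 2 t s) (VV u 2 t s))
      - 5 / 4 * (∫ s in (0 : ℝ)..ℓ, dt3 (VV u 1 t s) (VV u 1 t s) ^ 2) =
    (∫ s in (0 : ℝ)..ℓ, dt3 (VV u 2 0 s) (VV u 2 0 s))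
      - 5 / 4 * (∫ s in (0 : ℝ)..ℓ, dt3 (VV u 1 0 s) (VV u 1 0 s) ^ 2) := by
  have hd : ∀ t, HasDerivAt (fun t => (∫ s in (0 : ℝ)..ℓ, dt3 (VV u 2 t s) (VV u 2 t s))
      - 5 / 4 * (∫ s in (0 : ℝ)..ℓ, dt3 (VV u 1 t s) (VV u 1 t s) ^ 2)) 0 t := fun t => by
    refine ((h.e22 t).sub ((h.e14 t).const_mul (5 / 4))).congr_deriv ?_
    rw [intervalIntegral.integral_const_mul, intervalIntegral.integral_const_mul]
    ring
  exact is_const_of_deriv_eq_zero (fun t => (hd t).differentiableAt) (fun t => (hd t).deriv) t 0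

lemma e3_const (t : ℝ) : (∫ s in (0 : ℝ)..ℓ, dt3 (VV u 3 t s) (VV u 3 t s))
      - 7 / 2 * (∫ s in (0 : ℝ)..ℓ, dt3 (VV u 1 t s) (VV u 1 t s) * dt3 (VV u 2 t s) (VV u 2 t s))
      - 14 * (∫ s in (0 : ℝ)..ℓ, dt3 (VV u 1 t s) (VV u 2 t s) ^ 2)
      + 21 / 8 * (∫ s in (0 : ℝ)..ℓ, dt3 (VV u 1 t s) (VV u 1 t s) ^ 3) =
    (∫ s in (0 : ℝ)..ℓ, dt3 (VV u 3 0 s) (VV u 3 0 s))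
      - 7 / 2 * (∫ s in (0 : ℝ)..ℓ, dt3 (VV u 1 0 s) (VV u 1 0 s) * dt3 (VV u 2 0 s) (VV u 2 0 s))
      - 14 * (∫ s in (0 : ℝ)..ℓ, dt3 (VV u 1 0 s) (VV u 2 0 s) ^ 2)
      + 21 / 8 * (∫ s in (0 : ℝ)..ℓ, dt3 (VV u 1 0 s) (VV u 1 0 s) ^ 3) := by
  have hc := is_const_of_deriv_eq_zero (fun t => (h.e3 t).differentiableAt)
    (fun t => (h.e3 t).deriv) t 0
  have hsplit : ∀ t, (∫ s in (0 : ℝ)..ℓ,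
    (dt3 (VV u 3 t s) (VV u 3 t s)
      - 7 / 2 * (dt3 (VV u 1 t s) (VV u 1 t s) * dt3 (VV u 2 t s) (VV u 2 t s))
      - 14 * dt3 (VV u 1 t s) (VV u 2 t s) ^ 2
      + 21 / 8 * dt3 (VV u 1 t s) (VV u 1 t s) ^ 3)) =
      (∫ s in (0 : ℝ)..ℓ, dt3 (VV u 3 t s) (VV u 3 t s))
      - 7 / 2 * (∫ s in (0 : ℝ)..ℓ, dt3 (VV u 1 t s) (VV u 1 t s) * dt3 (VV u 2 t s) (VV u 2 t s))
      - 14 * (∫ s in (0 : ℝ)..ℓ, dt3 (VV u 1 t s) (VV u 2 t s) ^ 2)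
      + 21 / 8 * (∫ s in (0 : ℝ)..ℓ, dt3 (VV u 1 t s) (VV u 1 t s) ^ 3) := by
    intro t
    have c33 := h.pc 3 3 t
    have c11 := h.pc 1 1 t
    have c22 := h.pc 2 2 t
    have c12 := h.pc 1 2 t
    rw [intervalIntegral.integral_add, intervalIntegral.integral_sub,
      intervalIntegral.integral_sub, intervalIntegral.integral_const_mul,
      intervalIntegral.integral_const_mul, intervalIntegral.integral_const_mul]
    all_goals exact Continuous.intervalIntegrable (by fun_prop) _ _
  rw [hsplit, hsplit] at hc
  exact hc

/-- `∫ |u₁|²|u₂|²`. -/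
lemma b1122 (hℓ : 0 < ℓ) (t : ℝ) {S : ℝ}
    (hS : ∀ s ∈ Set.Icc 0 ℓ, dt3 (VV u 1 t s) (VV u 1 t s) ≤ S) :
    (∫ s in (0 : ℝ)..ℓ, dt3 (VV u 1 t s) (VV u 1 t s) * dt3 (VV u 2 t s) (VV u 2 t s)) ≤
      S * ∫ s in (0 : ℝ)..ℓ, dt3 (VV u 2 t s) (VV u 2 t s) := by
  rw [← intervalIntegral.integral_const_mul]
  refine intervalIntegral.integral_mono_on hℓ.le
    (((h.pc 1 1 t).mul (h.pc 2 2 t)).intervalIntegrable _ _)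
    (((h.pc 2 2 t).const_mul S).intervalIntegrable _ _) fun s hs => ?_
  exact mul_le_mul_of_nonneg_right (hS s hs) (h.p_nonneg 2 t s)

lemma b12 (hℓ : 0 < ℓ) (t : ℝ) :
    (∫ s in (0 : ℝ)..ℓ, dt3 (VV u 1 t s) (VV u 2 t s) ^ 2) ≤
    (∫ s in (0 : ℝ)..ℓ, dt3 (VV u 1 t s) (VV u 1 t s) * dt3 (VV u 2 t s) (VV u 2 t s)) := by
  refine intervalIntegral.integral_mono_on hℓ.le
    (((h.pc 1 2 t).pow 2).intervalIntegrable _ _)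
    (((h.pc 1 1 t).mul (h.pc 2 2 t)).intervalIntegrable _ _) fun s hs => ?_
  exact (dt3_det3_bound _ _ _ (h.c0 t s)).2

lemma b112 (hℓ : 0 < ℓ) (t : ℝ) {S : ℝ}
    (hS : ∀ s ∈ Set.Icc 0 ℓ, dt3 (VV u 1 t s) (VV u 1 t s) ≤ S) :
    (∫ s in (0 : ℝ)..ℓ, dt3 (VV u 1 t s) (VV u 1 t s) ^ 2) ≤
      S * ∫ s in (0 : ℝ)..ℓ, dt3 (VV u 1 t s) (VV u 1 t s) := by
  rw [← intervalIntegral.integral_const_mul]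
  refine intervalIntegral.integral_mono_on hℓ.le
    (((h.pc 1 1 t).pow 2).intervalIntegrable _ _)
    (((h.pc 1 1 t).const_mul S).intervalIntegrable _ _) fun s hs => ?_
  rw [sq]
  exact mul_le_mul_of_nonneg_right (hS s hs) (h.p_nonneg 1 t s)

lemma b113 (hℓ : 0 < ℓ) (t : ℝ) {S : ℝ}
    (hS : ∀ s ∈ Set.Icc 0 ℓ, dt3 (VV u 1 t s) (VV u 1 t s) ≤ S) :
    (∫ s in (0 : ℝ)..ℓ, dt3 (VV u 1 t s) (VV u 1 t s) ^ 3) ≤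
      S ^ 2 * ∫ s in (0 : ℝ)..ℓ, dt3 (VV u 1 t s) (VV u 1 t s) := by
  rw [← intervalIntegral.integral_const_mul]
  refine intervalIntegral.integral_mono_on hℓ.le
    (((h.pc 1 1 t).pow 3).intervalIntegrable _ _)
    (((h.pc 1 1 t).const_mul (S ^ 2)).intervalIntegrable _ _) fun s hs => ?_
  have h1 := hS s hs
  have h2 := h.p_nonneg 1 t s
  rw [pow_succ]
  gcongr

lemma deriv_bound (hℓ : 0 < ℓ) (t : ℝ) :
    |∫ s in (0 : ℝ)..ℓ, 10 * (dt3 (VV u 1 t s) (VV u 2 t s)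
      * det3 (VV u 0 t s) (VV u 1 t s) (VV u 2 t s))| ≤
    10 * ∫ s in (0 : ℝ)..ℓ, dt3 (VV u 1 t s) (VV u 1 t s) * dt3 (VV u 2 t s) (VV u 2 t s) := by
  rw [← intervalIntegral.integral_const_mul]
  refine (intervalIntegral.abs_integral_le_integral_abs hℓ.le).trans ?_
  refine intervalIntegral.integral_mono_on hℓ.le
    ((((h.pc 1 2 t).mul (h.wc 1 2 t)).const_mul 10).abs.intervalIntegrable _ _)
    ((((h.pc 1 1 t).mul (h.pc 2 2 t)).const_mul 10).intervalIntegrable _ _) fun s hs => ?_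
  have h1 := (dt3_det3_bound _ (VV u 1 t s) (VV u 2 t s) (h.c0 t s)).1
  rw [abs_le]
  constructor
  · nlinarith [sq_nonneg (dt3 (VV u 1 t s) (VV u 2 t s)
      + det3 (VV u 0 t s) (VV u 1 t s) (VV u 2 t s))]
  · nlinarith [sq_nonneg (dt3 (VV u 1 t s) (VV u 2 t s)
      - det3 (VV u 0 t s) (VV u 1 t s) (VV u 2 t s))]

/-- The bound of the second energy. -/
lemma n2_bound (hℓ : 0 < ℓ) (t : ℝ) :
    (∫ s in (0 : ℝ)..ℓ, dt3 (VV u 2 t s) (VV u 2 t s)) ≤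
      (∫ s in (0 : ℝ)..ℓ, dt3 (VV u 2 0 s) (VV u 2 0 s)) *
        exp (510 * ℓ * (∫ s in (0 : ℝ)..ℓ, dt3 (VV u 2 0 s) (VV u 2 0 s)) * |t|) := by
  refine gronwall_two (f := fun t => ∫ s in (0 : ℝ)..ℓ, dt3 (VV u 2 t s) (VV u 2 t s))
    (fun t => h.e22 t) (fun t => ?_) t
  refine (h.deriv_bound hℓ t).trans ?_
  have hS := fun s hs => h.sup_bound hℓ t (s := s) hs
  have k1 := h.b1122 hℓ t hS
  have k2 := h.b112 hℓ t hS
  have k3 := h.e2_const t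
  have k4 := h.n1_const t
  have k5 := h.poin1 hℓ 0
  have k6 := h.poin2 hℓ 0
  have k7 : 0 ≤ ∫ s in (0 : ℝ)..ℓ, dt3 (VV u 1 0 s) (VV u 1 0 s) ^ 2 :=
    intervalIntegral.integral_nonneg hℓ.le fun s _ => sq_nonneg _
  have n1 := h.n_nonneg hℓ 1 0
  have n2 := h.n_nonneg hℓ 2 0
  have n2t := h.n_nonneg hℓ 2 t
  rw [k4] at k1 k2
  clear k4 hS
  set N1 := ∫ s in (0 : ℝ)..ℓ, dt3 (VV u 1 0 s) (VV u 1 0 s)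
  set N2 := ∫ s in (0 : ℝ)..ℓ, dt3 (VV u 2 0 s) (VV u 2 0 s)
  set N2t := ∫ s in (0 : ℝ)..ℓ, dt3 (VV u 2 t s) (VV u 2 t s)
  set M := ∫ s in (0 : ℝ)..ℓ, dt3 (VV u 1 t s) (VV u 1 t s) ^ 2
  have ha := Real.sq_sqrt n1
  have hb := Real.sq_sqrt n2
  have hbt := Real.sq_sqrt n2t
  have ha0 := Real.sqrt_nonneg N1
  have hb0 := Real.sqrt_nonneg N2
  have hbt0 := Real.sqrt_nonneg N2t
  set a := √N1
  set b := √N2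
  set c := √N2t
  have h6 : a ≤ ℓ * b := by
    apply le_of_sq_le_sq _ (by positivity)
    rw [mul_pow, ha, hb]; exact k6
  have h4 : a ^ 4 ≤ 4 * ℓ * b ^ 2 := by
    rw [hb]; refine le_trans (le_of_eq ?_) k5; rw [← ha]; ring
  have hc : c ≤ b + 4 * a ^ 3 := by
    have e1 : c ^ 2 ≤ b ^ 2 + 15 / 4 * a ^ 3 * c := by
      rw [hbt, hb]
      rw [← ha] at k2
      nlinarith
    by_contra hcon
    push Not at hcon
    have a3 : 0 ≤ a ^ 3 := by positivity
    nlinarith [mul_nonneg a3 hb0, mul_nonneg a3 hbt0]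
  have hr : 30 * (a * c) ≤ 510 * ℓ * N2 := by
    rw [← hb]
    have e1 : a * c ≤ a * (b + 4 * a ^ 3) := by gcongr
    have e2 : a * b ≤ ℓ * b * b := by gcongr
    nlinarith
  calc _ ≤ 10 * (3 * (a * c) * N2t) := by gcongr
    _ = 30 * (a * c) * N2t := by ring
    _ ≤ _ := by gcongr

/-- The final bound in terms of the second energy at time `t`. -/
lemma n3_bound (hℓ : 0 < ℓ) (t : ℝ) :
    (∫ s in (0 : ℝ)..ℓ, dt3 (VV u 3 t s) (VV u 3 t s)) ≤
      (∫ s in (0 : ℝ)..ℓ, dt3 (VV u 3 0 s) (VV u 3 0 s)) +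
      95 * ℓ * (∫ s in (0 : ℝ)..ℓ, dt3 (VV u 2 0 s) (VV u 2 0 s)) ^ 2 +
      53 * ℓ * (∫ s in (0 : ℝ)..ℓ, dt3 (VV u 2 t s) (VV u 2 t s)) ^ 2 := by
  have k1 := h.b1122 hℓ t (fun s hs => h.sup_bound hℓ t (s := s) hs)
  have k2 := h.b12 hℓ t
  have k3 := h.b113 hℓ 0 (fun s hs => h.sup_bound hℓ 0 (s := s) hs)
  have k4 := h.e3_const t
  have k5 := h.poin1 hℓ 0
  have k6 := h.poin2 hℓ t
  have i1 : 0 ≤ ∫ s in (0 : ℝ)..ℓ, dt3 (VV u 1 0 s) (VV u 2 0 s) ^ 2 :=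
    intervalIntegral.integral_nonneg hℓ.le fun s _ => sq_nonneg _
  have i2 := i1.trans (h.b12 hℓ 0)
  have i3 : 0 ≤ ∫ s in (0 : ℝ)..ℓ, dt3 (VV u 1 t s) (VV u 1 t s) ^ 3 :=
    intervalIntegral.integral_nonneg hℓ.le fun s _ => pow_nonneg (h.p_nonneg 1 t s) 3
  have n1 := h.n_nonneg hℓ 1 0
  have n1t := h.n_nonneg hℓ 1 t
  have n2 := h.n_nonneg hℓ 2 0
  have n2t := h.n_nonneg hℓ 2 t
  set N1 := ∫ s in (0 : ℝ)..ℓ, dt3 (VV u 1 0 s) (VV u 1 0 s)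
  set N1t := ∫ s in (0 : ℝ)..ℓ, dt3 (VV u 1 t s) (VV u 1 t s)
  set N2 := ∫ s in (0 : ℝ)..ℓ, dt3 (VV u 2 0 s) (VV u 2 0 s)
  set N2t := ∫ s in (0 : ℝ)..ℓ, dt3 (VV u 2 t s) (VV u 2 t s)
  have e1 : √N1t * √N2t ≤ ℓ * N2t := by
    have : √N1t ≤ ℓ * √N2t := by
      apply le_of_sq_le_sq _ (by positivity)
      rw [mul_pow, Real.sq_sqrt n1t, Real.sq_sqrt n2t]; exact k6
    calc √N1t * √N2t ≤ ℓ * √N2t * √N2t := by gcongr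
      _ = ℓ * N2t := by rw [mul_assoc, Real.mul_self_sqrt n2t]
  have e2 : 3 * (√N1t * √N2t) * N2t ≤ 3 * ℓ * N2t ^ 2 := by
    calc 3 * (√N1t * √N2t) * N2t ≤ 3 * (ℓ * N2t) * N2t := by gcongr
      _ = _ := by ring
  have e3 : (3 * (√N1 * √N2)) ^ 2 * N1 ≤ 36 * ℓ * N2 ^ 2 := by
    calc (3 * (√N1 * √N2)) ^ 2 * N1 = 9 * N1 ^ 2 * N2 := by
          rw [mul_pow, mul_pow, Real.sq_sqrt n1, Real.sq_sqrt n2]; ring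
      _ ≤ 9 * (4 * ℓ * N2) * N2 := by gcongr
      _ = _ := by ring
  have p1 : 0 ≤ ℓ * N2 ^ 2 := by positivity
  have p2 : 0 ≤ ℓ * N2t ^ 2 := by positivity
  linarith

end IsFlow

/-- Corollary A.4: a priori `H³` bound for Schrödinger maps. -/
theorem stmt17
    (ℓ : ℝ) (hℓ : 0 < ℓ) :
    ∃ C : ℝ, 0 < C ∧
      ∀ u : ℝ → ℝ → R3,
        ContDiff ℝ (⊤ : ℕ∞) (fun p : ℝ × ℝ => u p.1 p.2) →
        (∀ t s : ℝ, u t (s + ℓ) = u t s) →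
        (∀ t s : ℝ, ‖u t s‖ = 1) →
        (∀ t s : ℝ,
          deriv (fun τ => u τ s) t =
            deriv (fun σ => cross3 (u t σ) (deriv (u t) σ)) s) →
        ∀ t : ℝ,
          (∫ s in (0:ℝ)..ℓ, ‖deriv (deriv (deriv (u t))) s‖ ^ 2) ≤
            C * ((∫ s in (0:ℝ)..ℓ, ‖deriv (deriv (u 0)) s‖ ^ 2) ^ 2
                + ∫ s in (0:ℝ)..ℓ, ‖deriv (deriv (deriv (u 0))) s‖ ^ 2)
              * Real.exp (C * ((∫ s in (0:ℝ)..ℓ, ‖deriv (u 0) s‖ ^ 2) ^ 3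
                + ∫ s in (0:ℝ)..ℓ, ‖deriv (deriv (u 0)) s‖ ^ 2) * |t|) := by
  refine ⟨1 + 1020 * ℓ, by positivity, fun u hu hper hunit heqn t => ?_⟩
  have h : IsFlow ℓ u := ⟨hu, hper, hunit, heqn⟩
  change (∫ s in (0:ℝ)..ℓ, ‖VV u 3 t s‖ ^ 2) ≤
    (1 + 1020 * ℓ) * ((∫ s in (0:ℝ)..ℓ, ‖VV u 2 0 s‖ ^ 2) ^ 2
      + ∫ s in (0:ℝ)..ℓ, ‖VV u 3 0 s‖ ^ 2)
    * Real.exp ((1 + 1020 * ℓ) * ((∫ s in (0:ℝ)..ℓ, ‖VV u 1 0 s‖ ^ 2) ^ 3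
      + ∫ s in (0:ℝ)..ℓ, ‖VV u 2 0 s‖ ^ 2) * |t|)
  simp only [h.int_norm_sq]
  have k1 := h.n3_bound hℓ t
  have k2 := h.n2_bound hℓ t
  have n1 := h.n_nonneg hℓ 1 0
  have n2 := h.n_nonneg hℓ 2 0
  have n2t := h.n_nonneg hℓ 2 t
  have n3 := h.n_nonneg hℓ 3 0
  set N1 := ∫ s in (0 : ℝ)..ℓ, dt3 (VV u 1 0 s) (VV u 1 0 s)
  set N2 := ∫ s in (0 : ℝ)..ℓ, dt3 (VV u 2 0 s) (VV u 2 0 s)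
  set N2t := ∫ s in (0 : ℝ)..ℓ, dt3 (VV u 2 t s) (VV u 2 t s)
  set N3 := ∫ s in (0 : ℝ)..ℓ, dt3 (VV u 3 0 s) (VV u 3 0 s)
  have ht := abs_nonneg t
  set X := exp ((1 + 1020 * ℓ) * (N1 ^ 3 + N2) * |t|) with hX
  have hX1 : 1 ≤ X := Real.one_le_exp (by positivity)
  have hX2 : N2t ^ 2 ≤ N2 ^ 2 * X := by
    calc N2t ^ 2 ≤ (N2 * exp (510 * ℓ * N2 * |t|)) ^ 2 := by gcongr
      _ = N2 ^ 2 * exp (1020 * ℓ * N2 * |t|) := by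
        rw [mul_pow, ← Real.exp_nat_mul]; congr 2; push_cast; ring
      _ ≤ N2 ^ 2 * X := by
        rw [hX]
        gcongr
        · linarith
        · have : 0 ≤ N1 ^ 3 := by positivity
          linarith
  have f1 : N3 ≤ N3 * X := le_mul_of_one_le_right n3 hX1
  have f2 : N2 ^ 2 ≤ N2 ^ 2 * X := le_mul_of_one_le_right (by positivity) hX1
  have g1 : ℓ * N2 ^ 2 ≤ ℓ * (N2 ^ 2 * X) := by gcongr
  have g2 : ℓ * N2t ^ 2 ≤ ℓ * (N2 ^ 2 * X) := by gcongr
  have q1 : 0 ≤ ℓ * (N2 ^ 2 * X) := by positivity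
  have q2 : 0 ≤ ℓ * (N3 * X) := by positivity
  have q3 : 0 ≤ N2 ^ 2 * X := by positivity
  nlinarith
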